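/- arXiv:2510.02577 — 3 statements merged into one kernel-verified Lean document; each statement's English description precedes it below -/
import Mathlib

section
/- Let κ ∈ ℝ and let u = (u₁,u₂) : ℝ² × ℝ → ℝ² and η : ℝ² × ℝ → ℝ be smooth with η > 0 everywhere, solving the 2D BKBK system: ∂_t u + (v·∇)u + Σ_{j=1,2} u_j ∇v_j = ∇𝓑 and ∂_t η + div(η v) = 0, where v := u − κ∇ln η and 𝓑 := |u|²/2 − (κ/η) div(η u) − η. Then the potential vorticity q := (∂₁u₂ − ∂₂u₁)/η satisfies the advection equation ∂_t q + v·∇q = 0 at every point. -/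
/-- partial derivative in the first spatial variable of a function of `(x, y, t)` -/
noncomputable def pd1 (f : ℝ → ℝ → ℝ → ℝ) (x y t : ℝ) : ℝ := deriv (fun x' => f x' y t) x

/-- partial derivative in the second spatial variable of a function of `(x, y, t)` -/
noncomputable def pd2 (f : ℝ → ℝ → ℝ → ℝ) (x y t : ℝ) : ℝ := deriv (fun y' => f x y' t) y

/-- temporal partial derivative of a function of `(x, y, t)` -/
noncomputable def pdt (f : ℝ → ℝ → ℝ → ℝ) (x y t : ℝ) : ℝ := deriv (fun t' => f x y t') t

open scoped ContDiff

/-- A function of `(x, y, t)` is smooth if it is jointly `C^∞` in its three variables. -/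
def Smooth3 (f : ℝ → ℝ → ℝ → ℝ) : Prop :=
  ContDiff ℝ ∞ (fun p : ℝ × ℝ × ℝ => f p.1 p.2.1 p.2.2)

/-- Directional derivatives of a smooth function commute. -/
theorem ContDiff.fderiv_fderiv_apply_comm {E : Type*} [NormedAddCommGroup E] [NormedSpace ℝ E]
    {F : E → ℝ} (hF : ContDiff ℝ ∞ F) (p v w : E) :
    fderiv ℝ (fun p => fderiv ℝ F p w) p v = fderiv ℝ (fun p => fderiv ℝ F p v) p w := by
  have hd : DifferentiableAt ℝ (fderiv ℝ F) p :=
    ((hF.fderiv_right (m := 1) (by norm_cast)).differentiable one_ne_zero) p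
  have hs : IsSymmSndFDerivAt ℝ F p :=
    hF.contDiffAt.isSymmSndFDerivAt (by simp; norm_cast)
  rw [fderiv_clm_apply hd (differentiableAt_const w),
    fderiv_clm_apply hd (differentiableAt_const v)]
  simpa using hs.eq v w

namespace Smooth3

variable {f g : ℝ → ℝ → ℝ → ℝ}

theorem differentiable (hf : Smooth3 f) :
    Differentiable ℝ (fun p : ℝ × ℝ × ℝ => f p.1 p.2.1 p.2.2) :=
  ContDiff.differentiable hf (by simp)

theorem const (c : ℝ) : Smooth3 (fun _ _ _ => c) := contDiff_const

theorem add (hf : Smooth3 f) (hg : Smooth3 g) : Smooth3 (fun x y t => f x y t + g x y t) :=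
  ContDiff.add hf hg

theorem sub (hf : Smooth3 f) (hg : Smooth3 g) : Smooth3 (fun x y t => f x y t - g x y t) :=
  ContDiff.sub hf hg

theorem mul (hf : Smooth3 f) (hg : Smooth3 g) : Smooth3 (fun x y t => f x y t * g x y t) :=
  ContDiff.mul hf hg

theorem div (hf : Smooth3 f) (hg : Smooth3 g) (h0 : ∀ x y t, g x y t ≠ 0) :
    Smooth3 (fun x y t => f x y t / g x y t) :=
  ContDiff.div hf hg fun _ => h0 _ _ _

theorem pow (hf : Smooth3 f) (n : ℕ) : Smooth3 (fun x y t => f x y t ^ n) :=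
  ContDiff.pow hf n

theorem log (hf : Smooth3 f) (h0 : ∀ x y t, f x y t ≠ 0) :
    Smooth3 (fun x y t => Real.log (f x y t)) :=
  ContDiff.log hf fun _ => h0 _ _ _

theorem hasDerivAt_pd1_fderiv (hf : Smooth3 f) (x y t : ℝ) :
    HasDerivAt (fun x => f x y t)
      (fderiv ℝ (fun p : ℝ × ℝ × ℝ => f p.1 p.2.1 p.2.2) (x, y, t) (1, 0, 0)) x :=
  HasFDerivAt.comp_hasDerivAt (f := fun x => (x, y, t)) x
    (hf.differentiable (x, y, t)).hasFDerivAt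
    ((hasDerivAt_id x).prodMk (hasDerivAt_const x (y, t)))

theorem pd1_eq_fderiv (hf : Smooth3 f) (x y t : ℝ) :
    pd1 f x y t = fderiv ℝ (fun p : ℝ × ℝ × ℝ => f p.1 p.2.1 p.2.2) (x, y, t) (1, 0, 0) :=
  (hf.hasDerivAt_pd1_fderiv x y t).deriv

theorem hasDerivAt_pd1 (hf : Smooth3 f) (x y t : ℝ) :
    HasDerivAt (fun x => f x y t) (pd1 f x y t) x :=
  (hf.hasDerivAt_pd1_fderiv x y t).differentiableAt.hasDerivAt

protected theorem pd1 (hf : Smooth3 f) : Smooth3 (pd1 f) := by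
  unfold Smooth3
  simp only [hf.pd1_eq_fderiv]
  exact (ContDiff.fderiv_right hf (m := ∞) (by simp)).clm_apply contDiff_const

theorem pd1_add (hf : Smooth3 f) (hg : Smooth3 g) (x y t : ℝ) :
    pd1 (fun x y t => f x y t + g x y t) x y t = pd1 f x y t + pd1 g x y t :=
  ((hf.hasDerivAt_pd1 x y t).add (hg.hasDerivAt_pd1 x y t)).deriv

theorem pd1_sub (hf : Smooth3 f) (hg : Smooth3 g) (x y t : ℝ) :
    pd1 (fun x y t => f x y t - g x y t) x y t = pd1 f x y t - pd1 g x y t :=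
  ((hf.hasDerivAt_pd1 x y t).sub (hg.hasDerivAt_pd1 x y t)).deriv

theorem pd1_mul (hf : Smooth3 f) (hg : Smooth3 g) (x y t : ℝ) :
    pd1 (fun x y t => f x y t * g x y t) x y t
      = pd1 f x y t * g x y t + f x y t * pd1 g x y t :=
  ((hf.hasDerivAt_pd1 x y t).mul (hg.hasDerivAt_pd1 x y t)).deriv

theorem pd1_div (hf : Smooth3 f) (hg : Smooth3 g) (h0 : ∀ x y t, g x y t ≠ 0) (x y t : ℝ) :
    pd1 (fun x y t => f x y t / g x y t) x y t
      = (pd1 f x y t * g x y t - f x y t * pd1 g x y t) / g x y t ^ 2 :=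
  ((hf.hasDerivAt_pd1 x y t).div (hg.hasDerivAt_pd1 x y t) (h0 x y t)).deriv

theorem hasDerivAt_pd2_fderiv (hf : Smooth3 f) (x y t : ℝ) :
    HasDerivAt (fun y => f x y t)
      (fderiv ℝ (fun p : ℝ × ℝ × ℝ => f p.1 p.2.1 p.2.2) (x, y, t) (0, 1, 0)) y :=
  HasFDerivAt.comp_hasDerivAt (f := fun y => (x, y, t)) y
    (hf.differentiable (x, y, t)).hasFDerivAt
    ((hasDerivAt_const y x).prodMk ((hasDerivAt_id y).prodMk (hasDerivAt_const y t)))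

theorem pd2_eq_fderiv (hf : Smooth3 f) (x y t : ℝ) :
    pd2 f x y t = fderiv ℝ (fun p : ℝ × ℝ × ℝ => f p.1 p.2.1 p.2.2) (x, y, t) (0, 1, 0) :=
  (hf.hasDerivAt_pd2_fderiv x y t).deriv

theorem hasDerivAt_pd2 (hf : Smooth3 f) (x y t : ℝ) :
    HasDerivAt (fun y => f x y t) (pd2 f x y t) y :=
  (hf.hasDerivAt_pd2_fderiv x y t).differentiableAt.hasDerivAt

protected theorem pd2 (hf : Smooth3 f) : Smooth3 (pd2 f) := by
  unfold Smooth3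
  simp only [hf.pd2_eq_fderiv]
  exact (ContDiff.fderiv_right hf (m := ∞) (by simp)).clm_apply contDiff_const

theorem pd2_add (hf : Smooth3 f) (hg : Smooth3 g) (x y t : ℝ) :
    pd2 (fun x y t => f x y t + g x y t) x y t = pd2 f x y t + pd2 g x y t :=
  ((hf.hasDerivAt_pd2 x y t).add (hg.hasDerivAt_pd2 x y t)).deriv

theorem pd2_sub (hf : Smooth3 f) (hg : Smooth3 g) (x y t : ℝ) :
    pd2 (fun x y t => f x y t - g x y t) x y t = pd2 f x y t - pd2 g x y t :=
  ((hf.hasDerivAt_pd2 x y t).sub (hg.hasDerivAt_pd2 x y t)).deriv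

theorem pd2_mul (hf : Smooth3 f) (hg : Smooth3 g) (x y t : ℝ) :
    pd2 (fun x y t => f x y t * g x y t) x y t
      = pd2 f x y t * g x y t + f x y t * pd2 g x y t :=
  ((hf.hasDerivAt_pd2 x y t).mul (hg.hasDerivAt_pd2 x y t)).deriv

theorem pd2_div (hf : Smooth3 f) (hg : Smooth3 g) (h0 : ∀ x y t, g x y t ≠ 0) (x y t : ℝ) :
    pd2 (fun x y t => f x y t / g x y t) x y t
      = (pd2 f x y t * g x y t - f x y t * pd2 g x y t) / g x y t ^ 2 :=
  ((hf.hasDerivAt_pd2 x y t).div (hg.hasDerivAt_pd2 x y t) (h0 x y t)).deriv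

theorem hasDerivAt_pdt_fderiv (hf : Smooth3 f) (x y t : ℝ) :
    HasDerivAt (fun t => f x y t)
      (fderiv ℝ (fun p : ℝ × ℝ × ℝ => f p.1 p.2.1 p.2.2) (x, y, t) (0, 0, 1)) t :=
  HasFDerivAt.comp_hasDerivAt (f := fun t => (x, y, t)) t
    (hf.differentiable (x, y, t)).hasFDerivAt
    ((hasDerivAt_const t x).prodMk ((hasDerivAt_const t y).prodMk (hasDerivAt_id t)))

theorem pdt_eq_fderiv (hf : Smooth3 f) (x y t : ℝ) :
    pdt f x y t = fderiv ℝ (fun p : ℝ × ℝ × ℝ => f p.1 p.2.1 p.2.2) (x, y, t) (0, 0, 1) :=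
  (hf.hasDerivAt_pdt_fderiv x y t).deriv

theorem hasDerivAt_pdt (hf : Smooth3 f) (x y t : ℝ) :
    HasDerivAt (fun t => f x y t) (pdt f x y t) t :=
  (hf.hasDerivAt_pdt_fderiv x y t).differentiableAt.hasDerivAt

protected theorem pdt (hf : Smooth3 f) : Smooth3 (pdt f) := by
  unfold Smooth3
  simp only [hf.pdt_eq_fderiv]
  exact (ContDiff.fderiv_right hf (m := ∞) (by simp)).clm_apply contDiff_const

theorem pdt_sub (hf : Smooth3 f) (hg : Smooth3 g) (x y t : ℝ) :
    pdt (fun x y t => f x y t - g x y t) x y t = pdt f x y t - pdt g x y t :=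
  ((hf.hasDerivAt_pdt x y t).sub (hg.hasDerivAt_pdt x y t)).deriv

theorem pdt_div (hf : Smooth3 f) (hg : Smooth3 g) (h0 : ∀ x y t, g x y t ≠ 0) (x y t : ℝ) :
    pdt (fun x y t => f x y t / g x y t) x y t
      = (pdt f x y t * g x y t - f x y t * pdt g x y t) / g x y t ^ 2 :=
  ((hf.hasDerivAt_pdt x y t).div (hg.hasDerivAt_pdt x y t) (h0 x y t)).deriv

theorem pd2_pd1_comm (hf : Smooth3 f) (x y t : ℝ) :
    pd2 (pd1 f) x y t = pd1 (pd2 f) x y t := by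
  rw [hf.pd1.pd2_eq_fderiv, hf.pd2.pd1_eq_fderiv]
  simp only [hf.pd2_eq_fderiv, hf.pd1_eq_fderiv]
  exact ContDiff.fderiv_fderiv_apply_comm hf _ _ _

theorem pdt_pd1_comm (hf : Smooth3 f) (x y t : ℝ) :
    pdt (pd1 f) x y t = pd1 (pdt f) x y t := by
  rw [hf.pd1.pdt_eq_fderiv, hf.pdt.pd1_eq_fderiv]
  simp only [hf.pdt_eq_fderiv, hf.pd1_eq_fderiv]
  exact ContDiff.fderiv_fderiv_apply_comm hf _ _ _

theorem pdt_pd2_comm (hf : Smooth3 f) (x y t : ℝ) :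
    pdt (pd2 f) x y t = pd2 (pdt f) x y t := by
  rw [hf.pd2.pdt_eq_fderiv, hf.pdt.pd2_eq_fderiv]
  simp only [hf.pdt_eq_fderiv, hf.pd2_eq_fderiv]
  exact ContDiff.fderiv_fderiv_apply_comm hf _ _ _

end Smooth3

/-- The curl of the momentum equation: `∂ₜω + v·∇ω + ω div v = 0` for `ω = ∂₁u₂ − ∂₂u₁`. -/
theorem vorticity_equation {u1 u2 v1 v2 B : ℝ → ℝ → ℝ → ℝ}
    (hu1 : Smooth3 u1) (hu2 : Smooth3 u2) (hv1 : Smooth3 v1) (hv2 : Smooth3 v2) (hB : Smooth3 B)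
    (hmom1 : ∀ x y t, pdt u1 x y t + v1 x y t * pd1 u1 x y t + v2 x y t * pd2 u1 x y t
        + u1 x y t * pd1 v1 x y t + u2 x y t * pd1 v2 x y t = pd1 B x y t)
    (hmom2 : ∀ x y t, pdt u2 x y t + v1 x y t * pd1 u2 x y t + v2 x y t * pd2 u2 x y t
        + u1 x y t * pd2 v1 x y t + u2 x y t * pd2 v2 x y t = pd2 B x y t) (x y t : ℝ) :
    (pdt (pd1 u2) x y t - pdt (pd2 u1) x y t)
      + v1 x y t * (pd1 (pd1 u2) x y t - pd1 (pd2 u1) x y t)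
      + v2 x y t * (pd2 (pd1 u2) x y t - pd2 (pd2 u1) x y t)
      + (pd1 v1 x y t + pd2 v2 x y t) * (pd1 u2 x y t - pd2 u1 x y t) = 0 := by
  have key1 := congrArg (fun f => pd2 f x y t) (funext fun x => funext fun y => funext (hmom1 x y))
  have key2 := congrArg (fun f => pd1 f x y t) (funext fun x => funext fun y => funext (hmom2 x y))
  beta_reduce at key1 key2
  rw [(((hu1.pdt.add (hv1.mul hu1.pd1)).add (hv2.mul hu1.pd2)).add (hu1.mul hv1.pd1)).pd2_add (hu2.mul hv2.pd1),
    ((hu1.pdt.add (hv1.mul hu1.pd1)).add (hv2.mul hu1.pd2)).pd2_add (hu1.mul hv1.pd1),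
    (hu1.pdt.add (hv1.mul hu1.pd1)).pd2_add (hv2.mul hu1.pd2),
    hu1.pdt.pd2_add (hv1.mul hu1.pd1),
    hv1.pd2_mul hu1.pd1,
    hv2.pd2_mul hu1.pd2,
    hu1.pd2_mul hv1.pd1,
    hu2.pd2_mul hv2.pd1] at key1
  rw [(((hu2.pdt.add (hv1.mul hu2.pd1)).add (hv2.mul hu2.pd2)).add (hu1.mul hv1.pd2)).pd1_add (hu2.mul hv2.pd2),
    ((hu2.pdt.add (hv1.mul hu2.pd1)).add (hv2.mul hu2.pd2)).pd1_add (hu1.mul hv1.pd2),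
    (hu2.pdt.add (hv1.mul hu2.pd1)).pd1_add (hv2.mul hu2.pd2),
    hu2.pdt.pd1_add (hv1.mul hu2.pd1),
    hv1.pd1_mul hu2.pd1,
    hv2.pd1_mul hu2.pd2,
    hu1.pd1_mul hv1.pd2,
    hu2.pd1_mul hv2.pd2] at key2
  rw [hB.pd2_pd1_comm, hu1.pd2_pd1_comm, hv1.pd2_pd1_comm, hv2.pd2_pd1_comm] at key1
  rw [hu2.pdt_pd1_comm, hu1.pdt_pd2_comm, hu2.pd2_pd1_comm]
  linear_combination key2 - key1

/-- For smooth solutions of the 2D BKBK system with `η > 0`, the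
potential vorticity `q := (∂₁u₂ − ∂₂u₁)/η` is advected by the modified transport
velocity `v = u − κ∇ln η`:  `∂ₜq + v·∇q = 0`. -/
theorem bkbk_2d_pv_advection (κ : ℝ) (u1 u2 η : ℝ → ℝ → ℝ → ℝ)
    (hu1 : ContDiff ℝ (⊤ : ℕ∞) (fun p : ℝ × ℝ × ℝ => u1 p.1 p.2.1 p.2.2))
    (hu2 : ContDiff ℝ (⊤ : ℕ∞) (fun p : ℝ × ℝ × ℝ => u2 p.1 p.2.1 p.2.2))
    (hη : ContDiff ℝ (⊤ : ℕ∞) (fun p : ℝ × ℝ × ℝ => η p.1 p.2.1 p.2.2))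
    (hηpos : ∀ x y t, 0 < η x y t)
    (v1 v2 B : ℝ → ℝ → ℝ → ℝ)
    (hv1 : v1 = fun x y t => u1 x y t - κ * pd1 (fun x y t => Real.log (η x y t)) x y t)
    (hv2 : v2 = fun x y t => u2 x y t - κ * pd2 (fun x y t => Real.log (η x y t)) x y t)
    (hB : B = fun x y t => (u1 x y t ^ 2 + u2 x y t ^ 2) / 2
        - (κ / η x y t) * (pd1 (fun x y t => η x y t * u1 x y t) x y t
            + pd2 (fun x y t => η x y t * u2 x y t) x y t)
        - η x y t)
    (hmom1 : ∀ x y t, pdt u1 x y t + v1 x y t * pd1 u1 x y t + v2 x y t * pd2 u1 x y t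
        + u1 x y t * pd1 v1 x y t + u2 x y t * pd1 v2 x y t = pd1 B x y t)
    (hmom2 : ∀ x y t, pdt u2 x y t + v1 x y t * pd1 u2 x y t + v2 x y t * pd2 u2 x y t
        + u1 x y t * pd2 v1 x y t + u2 x y t * pd2 v2 x y t = pd2 B x y t)
    (hcont : ∀ x y t, pdt η x y t + pd1 (fun x y t => η x y t * v1 x y t) x y t
        + pd2 (fun x y t => η x y t * v2 x y t) x y t = 0)
    (q : ℝ → ℝ → ℝ → ℝ)
    (hq : q = fun x y t => (pd1 u2 x y t - pd2 u1 x y t) / η x y t) :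
    ∀ x y t, pdt q x y t + v1 x y t * pd1 q x y t + v2 x y t * pd2 q x y t = 0 := by
  have hU1 : Smooth3 u1 := hu1
  have hU2 : Smooth3 u2 := hu2
  have hN : Smooth3 η := hη
  have h0 : ∀ x y t, η x y t ≠ 0 := fun x y t => (hηpos x y t).ne'
  have hV1 : Smooth3 v1 := hv1 ▸ hU1.sub ((Smooth3.const κ).mul (hN.log h0).pd1)
  have hV2 : Smooth3 v2 := hv2 ▸ hU2.sub ((Smooth3.const κ).mul (hN.log h0).pd2)
  have hBs : Smooth3 B := hB ▸
    ((((hU1.pow 2).add (hU2.pow 2)).div (Smooth3.const 2) fun _ _ _ => two_ne_zero).sub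
      (((Smooth3.const κ).div hN h0).mul ((hN.mul hU1).pd1.add (hN.mul hU2).pd2))).sub hN
  intro x y t
  have hvort := vorticity_equation hU1 hU2 hV1 hV2 hBs hmom1 hmom2 x y t
  have hc := hcont x y t
  rw [hN.pd1_mul hV1, hN.pd2_mul hV2] at hc
  have hW := hU2.pd1.sub hU1.pd2
  rw [hq, hW.pdt_div hN h0, hW.pd1_div hN h0, hW.pd2_div hN h0, hU2.pd1.pdt_sub hU1.pd2,
    hU2.pd1.pd1_sub hU1.pd2, hU2.pd1.pd2_sub hU1.pd2]
  have hne := h0 x y t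
  field_simp
  linear_combination η x y t * hvort - (pd1 u2 x y t - pd2 u1 x y t) * hc
end

section
/- Let κ ∈ ℝ and let u = (u₁,u₂) : ℝ² × ℝ → ℝ² and η : ℝ² × ℝ → ℝ be smooth with η > 0, solving the 2D BKBK system ∂_t u + (v·∇)u + Σ_{j=1,2} u_j ∇v_j = ∇𝓑, ∂_t η + div(η v) = 0, where v := u − κ∇ln η and 𝓑 := |u|²/2 − (κ/η) div(η u) − η. Set ω := ∂₁u₂ − ∂₂u₁ and B̃ := |u|²/2 + κ div u + η. Then at every point: ∂_t u₁ − ω v₂ = −∂₁B̃ and ∂_t u₂ + ω v₁ = −∂₂B̃; that is, ∂_t u − v × (ω ẑ) = −∇B̃. -/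
/-- joint smoothness of a function of `(x, y, t)` -/
def SmoothXYT (f : ℝ → ℝ → ℝ → ℝ) : Prop :=
  ContDiff ℝ (⊤ : ℕ∞) (fun p : ℝ × ℝ × ℝ => f p.1 p.2.1 p.2.2)

namespace SmoothXYT

variable {f : ℝ → ℝ → ℝ → ℝ}

theorem hasDerivAt_fst (hf : SmoothXYT f) (x y t : ℝ) :
    HasDerivAt (fun x' => f x' y t) (pd1 f x y t) x := by
  have h : ContDiff ℝ (⊤ : ℕ∞) (fun x' : ℝ => f x' y t) :=
    ContDiff.comp (g := fun p : ℝ × ℝ × ℝ => f p.1 p.2.1 p.2.2)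
      (f := fun x' : ℝ => (x', y, t)) hf (by fun_prop)
  exact (h.differentiable (by simp) x).hasDerivAt

theorem hasDerivAt_snd (hf : SmoothXYT f) (x y t : ℝ) :
    HasDerivAt (fun y' => f x y' t) (pd2 f x y t) y := by
  have h : ContDiff ℝ (⊤ : ℕ∞) (fun y' : ℝ => f x y' t) :=
    ContDiff.comp (g := fun p : ℝ × ℝ × ℝ => f p.1 p.2.1 p.2.2)
      (f := fun y' : ℝ => (x, y', t)) hf (by fun_prop)
  exact (h.differentiable (by simp) y).hasDerivAt

theorem partial1 (hf : SmoothXYT f) : SmoothXYT (pd1 f) := by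
  have h : ∀ p : ℝ × ℝ × ℝ, pd1 f p.1 p.2.1 p.2.2 =
      fderiv ℝ (fun p : ℝ × ℝ × ℝ => f p.1 p.2.1 p.2.2) p (1, 0, 0) := by
    intro p
    have hd := (ContDiff.differentiable hf (by simp) p).hasFDerivAt
    have hc : HasDerivAt (fun x' : ℝ => (x', p.2.1, p.2.2)) ((1 : ℝ), (0 : ℝ), (0 : ℝ)) p.1 :=
      (hasDerivAt_id p.1).prodMk (hasDerivAt_const p.1 (p.2.1, p.2.2))
    exact (HasFDerivAt.comp_hasDerivAt p.1 hd hc).deriv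
  unfold SmoothXYT
  simp only [h]
  exact (ContDiff.fderiv_right hf (by simp)).clm_apply contDiff_const

theorem partial2 (hf : SmoothXYT f) : SmoothXYT (pd2 f) := by
  have h : ∀ p : ℝ × ℝ × ℝ, pd2 f p.1 p.2.1 p.2.2 =
      fderiv ℝ (fun p : ℝ × ℝ × ℝ => f p.1 p.2.1 p.2.2) p (0, 1, 0) := by
    intro p
    have hd := (ContDiff.differentiable hf (by simp) p).hasFDerivAt
    have hc : HasDerivAt (fun y' : ℝ => (p.1, y', p.2.2)) ((0 : ℝ), (1 : ℝ), (0 : ℝ)) p.2.1 :=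
      (hasDerivAt_const p.2.1 p.1).prodMk
        ((hasDerivAt_id p.2.1).prodMk (hasDerivAt_const p.2.1 p.2.2))
    exact (HasFDerivAt.comp_hasDerivAt p.2.1 hd hc).deriv
  unfold SmoothXYT
  simp only [h]
  exact (ContDiff.fderiv_right hf (by simp)).clm_apply contDiff_const

theorem log (hf : SmoothXYT f) (hpos : ∀ x y t, 0 < f x y t) :
    SmoothXYT (fun x y t => Real.log (f x y t)) :=
  ContDiff.log hf fun p => (hpos p.1 p.2.1 p.2.2).ne'

end SmoothXYT

/-- For smooth solutions of the 2D BKBK system with `η > 0`, setting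
`ω := ∂₁u₂ − ∂₂u₁` and `B̃ := |u|²/2 + κ div u + η`, the momentum equation takes the
curl form `∂ₜu − v × (ωẑ) = −∇B̃`, i.e. `∂ₜu₁ − ωv₂ = −∂₁B̃` and `∂ₜu₂ + ωv₁ = −∂₂B̃`. -/
theorem bkbk_2d_curl_form (κ : ℝ) (u1 u2 η : ℝ → ℝ → ℝ → ℝ)
    (hu1 : ContDiff ℝ (⊤ : ℕ∞) (fun p : ℝ × ℝ × ℝ => u1 p.1 p.2.1 p.2.2))
    (hu2 : ContDiff ℝ (⊤ : ℕ∞) (fun p : ℝ × ℝ × ℝ => u2 p.1 p.2.1 p.2.2))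
    (hη : ContDiff ℝ (⊤ : ℕ∞) (fun p : ℝ × ℝ × ℝ => η p.1 p.2.1 p.2.2))
    (hηpos : ∀ x y t, 0 < η x y t)
    (v1 v2 B : ℝ → ℝ → ℝ → ℝ)
    (hv1 : v1 = fun x y t => u1 x y t - κ * pd1 (fun x y t => Real.log (η x y t)) x y t)
    (hv2 : v2 = fun x y t => u2 x y t - κ * pd2 (fun x y t => Real.log (η x y t)) x y t)
    (hB : B = fun x y t => (u1 x y t ^ 2 + u2 x y t ^ 2) / 2
        - (κ / η x y t) * (pd1 (fun x y t => η x y t * u1 x y t) x y t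
            + pd2 (fun x y t => η x y t * u2 x y t) x y t)
        - η x y t)
    (hmom1 : ∀ x y t, pdt u1 x y t + v1 x y t * pd1 u1 x y t + v2 x y t * pd2 u1 x y t
        + u1 x y t * pd1 v1 x y t + u2 x y t * pd1 v2 x y t = pd1 B x y t)
    (hmom2 : ∀ x y t, pdt u2 x y t + v1 x y t * pd1 u2 x y t + v2 x y t * pd2 u2 x y t
        + u1 x y t * pd2 v1 x y t + u2 x y t * pd2 v2 x y t = pd2 B x y t)
    (hcont : ∀ x y t, pdt η x y t + pd1 (fun x y t => η x y t * v1 x y t) x y t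
        + pd2 (fun x y t => η x y t * v2 x y t) x y t = 0)
    (ω Bt : ℝ → ℝ → ℝ → ℝ)
    (hω : ω = fun x y t => pd1 u2 x y t - pd2 u1 x y t)
    (hBt : Bt = fun x y t => (u1 x y t ^ 2 + u2 x y t ^ 2) / 2
        + κ * (pd1 u1 x y t + pd2 u2 x y t) + η x y t) :
    (∀ x y t, pdt u1 x y t - ω x y t * v2 x y t = - pd1 Bt x y t) ∧
    (∀ x y t, pdt u2 x y t + ω x y t * v1 x y t = - pd2 Bt x y t) := by
  have su1 : SmoothXYT u1 := hu1
  have su2 : SmoothXYT u2 := hu2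
  have sη : SmoothXYT η := hη
  have sL := sη.log hηpos
  have hL1 : ∀ x y t, pd1 (fun x y t => Real.log (η x y t)) x y t = pd1 η x y t / η x y t :=
    fun x y t => ((sη.hasDerivAt_fst x y t).log (hηpos x y t).ne').deriv
  have hL2 : ∀ x y t, pd2 (fun x y t => Real.log (η x y t)) x y t = pd2 η x y t / η x y t :=
    fun x y t => ((sη.hasDerivAt_snd x y t).log (hηpos x y t).ne').deriv
  have hB' : B = fun x y t => (u1 x y t ^ 2 + u2 x y t ^ 2) / 2
      - κ * (pd1 u1 x y t + pd2 u2 x y t)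
      - κ * (u1 x y t * pd1 (fun x y t => Real.log (η x y t)) x y t
        + u2 x y t * pd2 (fun x y t => Real.log (η x y t)) x y t)
      - η x y t := by
    rw [hB]
    funext x y t
    have h1 : pd1 (fun x y t => η x y t * u1 x y t) x y t
        = pd1 η x y t * u1 x y t + η x y t * pd1 u1 x y t :=
      ((sη.hasDerivAt_fst x y t).mul (su1.hasDerivAt_fst x y t)).deriv
    have h2 : pd2 (fun x y t => η x y t * u2 x y t) x y t
        = pd2 η x y t * u2 x y t + η x y t * pd2 u2 x y t :=
      ((sη.hasDerivAt_snd x y t).mul (su2.hasDerivAt_snd x y t)).deriv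
    have hne := (hηpos x y t).ne'
    rw [h1, h2, hL1, hL2]
    field_simp
    ring
  clear hB hL1 hL2 hcont
  generalize (fun x y t => Real.log (η x y t)) = L at *
  subst hv1 hv2 hB' hω hBt
  constructor
  · intro x y t
    have e1 : pd1 (fun x y t => u1 x y t - κ * pd1 L x y t) x y t
        = pd1 u1 x y t - κ * pd1 (pd1 L) x y t :=
      ((su1.hasDerivAt_fst x y t).sub ((sL.partial1.hasDerivAt_fst x y t).const_mul κ)).deriv
    have e2 : pd1 (fun x y t => u2 x y t - κ * pd2 L x y t) x y t
        = pd1 u2 x y t - κ * pd1 (pd2 L) x y t :=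
      ((su2.hasDerivAt_fst x y t).sub ((sL.partial2.hasDerivAt_fst x y t).const_mul κ)).deriv
    have hsq := (((su1.hasDerivAt_fst x y t).pow 2).add ((su2.hasDerivAt_fst x y t).pow 2)).div_const 2
    have hdiv := ((su1.partial1.hasDerivAt_fst x y t).add (su2.partial2.hasDerivAt_fst x y t)).const_mul κ
    have hadv := (((su1.hasDerivAt_fst x y t).mul (sL.partial1.hasDerivAt_fst x y t)).add
      ((su2.hasDerivAt_fst x y t).mul (sL.partial2.hasDerivAt_fst x y t))).const_mul κ
    have e3 := (((hsq.sub hdiv).sub hadv).sub (sη.hasDerivAt_fst x y t)).deriv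
    have e4 := ((hsq.add hdiv).add (sη.hasDerivAt_fst x y t)).deriv
    have hm := hmom1 x y t
    rw [e1, e2] at hm
    change _ = deriv _ x at hm
    change _ = - deriv _ x
    erw [e3] at hm
    erw [e4]
    simp only [Nat.cast_ofNat, Nat.add_one_sub_one, pow_one] at hm ⊢
    linear_combination hm
  · intro x y t
    have e1 : pd2 (fun x y t => u1 x y t - κ * pd1 L x y t) x y t
        = pd2 u1 x y t - κ * pd2 (pd1 L) x y t :=
      ((su1.hasDerivAt_snd x y t).sub ((sL.partial1.hasDerivAt_snd x y t).const_mul κ)).deriv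
    have e2 : pd2 (fun x y t => u2 x y t - κ * pd2 L x y t) x y t
        = pd2 u2 x y t - κ * pd2 (pd2 L) x y t :=
      ((su2.hasDerivAt_snd x y t).sub ((sL.partial2.hasDerivAt_snd x y t).const_mul κ)).deriv
    have hsq := (((su1.hasDerivAt_snd x y t).pow 2).add ((su2.hasDerivAt_snd x y t).pow 2)).div_const 2
    have hdiv := ((su1.partial1.hasDerivAt_snd x y t).add (su2.partial2.hasDerivAt_snd x y t)).const_mul κ
    have hadv := (((su1.hasDerivAt_snd x y t).mul (sL.partial1.hasDerivAt_snd x y t)).add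
      ((su2.hasDerivAt_snd x y t).mul (sL.partial2.hasDerivAt_snd x y t))).const_mul κ
    have e3 := (((hsq.sub hdiv).sub hadv).sub (sη.hasDerivAt_snd x y t)).deriv
    have e4 := ((hsq.add hdiv).add (sη.hasDerivAt_snd x y t)).deriv
    have hm := hmom2 x y t
    rw [e1, e2] at hm
    change _ = deriv _ y at hm
    change _ = - deriv _ y
    erw [e3] at hm
    erw [e4]
    simp only [Nat.cast_ofNat, Nat.add_one_sub_one, pow_one] at hm ⊢
    linear_combination hm
end

section
/- Let κ ∈ ℝ and let u = (u₁,u₂) : ℝ² × ℝ → ℝ² and η : ℝ² × ℝ → ℝ be smooth with η > 0, solving the 2D BKBK system ∂_t u + (v·∇)u + Σ_{j=1,2} u_j ∇v_j = ∇𝓑, ∂_t η + div(η v) = 0, where v := u − κ∇ln η and 𝓑 := |u|²/2 − (κ/η) div(η u) − η. Then the vorticity ω := ∂₁u₂ − ∂₂u₁ satisfies the conservation-law form ∂_t ω + div(ω v) = 0, equivalently ∂_t ω + v·∇ω + ω div v = 0, at every point. -/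
/-- joint smoothness of a function of `(x, y, t)` -/
def JointlySmooth (f : ℝ → ℝ → ℝ → ℝ) : Prop :=
  ContDiff ℝ (⊤ : ℕ∞) (fun p : ℝ × ℝ × ℝ => f p.1 p.2.1 p.2.2)

/-- directional derivative of a function of `(x, y, t)` -/
noncomputable def dirDeriv (d : ℝ × ℝ × ℝ) (f : ℝ → ℝ → ℝ → ℝ) (x y t : ℝ) : ℝ :=
  fderiv ℝ (fun p : ℝ × ℝ × ℝ => f p.1 p.2.1 p.2.2) (x, y, t) d

namespace JointlySmooth

variable {f g : ℝ → ℝ → ℝ → ℝ}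

theorem differentiableAt (hf : JointlySmooth f) (p : ℝ × ℝ × ℝ) :
    DifferentiableAt ℝ (fun p : ℝ × ℝ × ℝ => f p.1 p.2.1 p.2.2) p :=
  (ContDiff.differentiable hf (by simp)).differentiableAt

theorem pd1_eq (hf : JointlySmooth f) : pd1 f = dirDeriv (1, 0, 0) f := by
  funext x y t
  have hc : HasDerivAt (fun x' : ℝ => (x', y, t)) ((1, 0, 0) : ℝ × ℝ × ℝ) x :=
    (hasDerivAt_id x).prodMk (hasDerivAt_const x (y, t))
  exact ((hf.differentiableAt (x, y, t)).hasFDerivAt.comp_hasDerivAt x hc).deriv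

theorem pd2_eq (hf : JointlySmooth f) : pd2 f = dirDeriv (0, 1, 0) f := by
  funext x y t
  have hc : HasDerivAt (fun y' : ℝ => (x, y', t)) ((0, 1, 0) : ℝ × ℝ × ℝ) y :=
    (hasDerivAt_const y x).prodMk ((hasDerivAt_id y).prodMk (hasDerivAt_const y t))
  exact ((hf.differentiableAt (x, y, t)).hasFDerivAt.comp_hasDerivAt y hc).deriv

theorem pdt_eq (hf : JointlySmooth f) : pdt f = dirDeriv (0, 0, 1) f := by
  funext x y t
  have hc : HasDerivAt (fun t' : ℝ => (x, y, t')) ((0, 0, 1) : ℝ × ℝ × ℝ) t :=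
    (hasDerivAt_const t x).prodMk ((hasDerivAt_const t y).prodMk (hasDerivAt_id t))
  exact ((hf.differentiableAt (x, y, t)).hasFDerivAt.comp_hasDerivAt t hc).deriv

theorem dirDeriv (hf : JointlySmooth f) (d : ℝ × ℝ × ℝ) : JointlySmooth (dirDeriv d f) :=
  (ContDiff.fderiv_right hf (m := ((⊤ : ℕ∞) : WithTop ℕ∞)) (by simp)).clm_apply contDiff_const

theorem pd1 (hf : JointlySmooth f) : JointlySmooth (pd1 f) := hf.pd1_eq ▸ hf.dirDeriv _

theorem pd2 (hf : JointlySmooth f) : JointlySmooth (pd2 f) := hf.pd2_eq ▸ hf.dirDeriv _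

theorem add (hf : JointlySmooth f) (hg : JointlySmooth g) :
    JointlySmooth (fun x y t => f x y t + g x y t) := ContDiff.add hf hg

theorem sub (hf : JointlySmooth f) (hg : JointlySmooth g) :
    JointlySmooth (fun x y t => f x y t - g x y t) := ContDiff.sub hf hg

theorem mul (hf : JointlySmooth f) (hg : JointlySmooth g) :
    JointlySmooth (fun x y t => f x y t * g x y t) := ContDiff.mul hf hg

theorem const (c : ℝ) : JointlySmooth (fun _ _ _ => c) := contDiff_const

theorem log (hf : JointlySmooth f) (h : ∀ x y t, f x y t ≠ 0) :
    JointlySmooth (fun x y t => Real.log (f x y t)) :=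
  ContDiff.log hf fun p => h p.1 p.2.1 p.2.2

theorem div (hf : JointlySmooth f) (hg : JointlySmooth g) (h : ∀ x y t, g x y t ≠ 0) :
    JointlySmooth (fun x y t => f x y t / g x y t) :=
  ContDiff.div hf hg fun p => h p.1 p.2.1 p.2.2

theorem dirDeriv_add (hf : JointlySmooth f) (hg : JointlySmooth g) (d : ℝ × ℝ × ℝ) (x y t : ℝ) :
    _root_.dirDeriv d (fun x y t => f x y t + g x y t) x y t =
      _root_.dirDeriv d f x y t + _root_.dirDeriv d g x y t := by
  simp only [_root_.dirDeriv]
  rw [fderiv_fun_add (hf.differentiableAt _) (hg.differentiableAt _)]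
  rfl

theorem dirDeriv_sub (hf : JointlySmooth f) (hg : JointlySmooth g) (d : ℝ × ℝ × ℝ) (x y t : ℝ) :
    _root_.dirDeriv d (fun x y t => f x y t - g x y t) x y t =
      _root_.dirDeriv d f x y t - _root_.dirDeriv d g x y t := by
  simp only [_root_.dirDeriv]
  rw [fderiv_fun_sub (hf.differentiableAt _) (hg.differentiableAt _)]
  rfl

theorem dirDeriv_mul (hf : JointlySmooth f) (hg : JointlySmooth g) (d : ℝ × ℝ × ℝ) (x y t : ℝ) :
    _root_.dirDeriv d (fun x y t => f x y t * g x y t) x y t =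
      f x y t * _root_.dirDeriv d g x y t + g x y t * _root_.dirDeriv d f x y t := by
  simp only [_root_.dirDeriv]
  rw [fderiv_fun_mul (hf.differentiableAt _) (hg.differentiableAt _)]
  rfl

/-- symmetry of second derivatives -/
theorem dirDeriv_comm (hf : JointlySmooth f) (d e : ℝ × ℝ × ℝ) :
    _root_.dirDeriv d (_root_.dirDeriv e f) = _root_.dirDeriv e (_root_.dirDeriv d f) := by
  have hd : ∀ p, DifferentiableAt ℝ
      (fderiv ℝ (fun p : ℝ × ℝ × ℝ => f p.1 p.2.1 p.2.2)) p := fun p =>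
    ((ContDiff.fderiv_right hf (m := ((⊤ : ℕ∞) : WithTop ℕ∞)) (by simp)).differentiable
      (by simp)).differentiableAt
  have key : ∀ a b : ℝ × ℝ × ℝ, ∀ x y t, _root_.dirDeriv a (_root_.dirDeriv b f) x y t =
      fderiv ℝ (fderiv ℝ (fun p : ℝ × ℝ × ℝ => f p.1 p.2.1 p.2.2)) (x, y, t) a b := by
    intro a b x y t
    have h := (hd (x, y, t)).hasFDerivAt.clm_apply (hasFDerivAt_const b (x, y, t))
    simpa [_root_.dirDeriv] using DFunLike.congr_fun h.fderiv a
  funext x y t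
  rw [key, key]
  exact (ContDiff.contDiffAt hf).isSymmSndFDerivAt
    (by simpa using WithTop.coe_le_coe.2 (le_top : (2 : ℕ∞) ≤ ⊤)) d e

end JointlySmooth

/-- Taking the curl of a momentum equation whose transport velocity `v` is an arbitrary smooth
field and whose right-hand side is an arbitrary smooth gradient gives the conservation law for the
vorticity. -/
theorem vorticity_conservation {u1 u2 v1 v2 B : ℝ → ℝ → ℝ → ℝ}
    (hu1 : JointlySmooth u1) (hu2 : JointlySmooth u2) (hv1 : JointlySmooth v1)
    (hv2 : JointlySmooth v2) (hB : JointlySmooth B)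
    (hmom1 : ∀ x y t, pdt u1 x y t + v1 x y t * pd1 u1 x y t + v2 x y t * pd2 u1 x y t
        + u1 x y t * pd1 v1 x y t + u2 x y t * pd1 v2 x y t = pd1 B x y t)
    (hmom2 : ∀ x y t, pdt u2 x y t + v1 x y t * pd1 u2 x y t + v2 x y t * pd2 u2 x y t
        + u1 x y t * pd2 v1 x y t + u2 x y t * pd2 v2 x y t = pd2 B x y t)
    {ω : ℝ → ℝ → ℝ → ℝ} (hω : ω = fun x y t => pd1 u2 x y t - pd2 u1 x y t) (x y t : ℝ) :
    pdt ω x y t + pd1 (fun x y t => ω x y t * v1 x y t) x y t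
        + pd2 (fun x y t => ω x y t * v2 x y t) x y t = 0 := by
  have sω : JointlySmooth ω := hω ▸ hu2.pd1.sub hu1.pd2
  have sω1 := sω.mul hv1
  have sω2 := sω.mul hv2
  have s1 := hu1.mul hv1
  have s2 := hu2.mul hv2
  have sG := (s1.add s2).sub hB
  rw [hu2.pd1_eq, hu1.pd2_eq] at hω
  have e1 : dirDeriv (0, 0, 1) u1 = fun x y t => ω x y t * v2 x y t - dirDeriv (1, 0, 0)
      (fun x y t => u1 x y t * v1 x y t + u2 x y t * v2 x y t - B x y t) x y t := by
    funext x y t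
    have h := hmom1 x y t
    rw [hu1.pdt_eq, hu1.pd1_eq, hu1.pd2_eq, hv1.pd1_eq, hv2.pd1_eq, hB.pd1_eq] at h
    rw [(s1.add s2).dirDeriv_sub hB, s1.dirDeriv_add s2, hu1.dirDeriv_mul hv1,
      hu2.dirDeriv_mul hv2, hω]
    linear_combination h
  have e2 : dirDeriv (0, 0, 1) u2 = fun x y t => (0 - ω x y t * v1 x y t) - dirDeriv (0, 1, 0)
      (fun x y t => u1 x y t * v1 x y t + u2 x y t * v2 x y t - B x y t) x y t := by
    funext x y t
    have h := hmom2 x y t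
    rw [hu2.pdt_eq, hu2.pd1_eq, hu2.pd2_eq, hv1.pd2_eq, hv2.pd2_eq, hB.pd2_eq] at h
    rw [(s1.add s2).dirDeriv_sub hB, s1.dirDeriv_add s2, hu1.dirDeriv_mul hv1,
      hu2.dirDeriv_mul hv2, hω]
    linear_combination h
  have h0 : dirDeriv (1, 0, 0) (fun _ _ _ => (0 : ℝ)) x y t = 0 := by simp [dirDeriv]
  have et : dirDeriv (0, 0, 1) ω x y t =
      dirDeriv (1, 0, 0) (dirDeriv (0, 0, 1) u2) x y t
        - dirDeriv (0, 1, 0) (dirDeriv (0, 0, 1) u1) x y t := by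
    rw [hω, (hu2.dirDeriv _).dirDeriv_sub (hu1.dirDeriv _), hu2.dirDeriv_comm,
      hu1.dirDeriv_comm]
  rw [e1, e2, ((JointlySmooth.const 0).sub sω1).dirDeriv_sub (sG.dirDeriv _),
    (JointlySmooth.const 0).dirDeriv_sub sω1, h0, sω2.dirDeriv_sub (sG.dirDeriv _),
    sG.dirDeriv_comm (1, 0, 0) (0, 1, 0)] at et
  rw [sω.pdt_eq, sω1.pd1_eq, sω2.pd2_eq, et]
  ring

/-- For smooth solutions of the 2D BKBK system with `η > 0`, the
vorticity `ω := ∂₁u₂ − ∂₂u₁` satisfies the conservation-law form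
`∂ₜω + div(ωv) = 0`, equivalently `∂ₜω + v·∇ω + ω div v = 0`. -/
theorem bkbk_2d_vorticity_transport (κ : ℝ) (u1 u2 η : ℝ → ℝ → ℝ → ℝ)
    (hu1 : ContDiff ℝ (⊤ : ℕ∞) (fun p : ℝ × ℝ × ℝ => u1 p.1 p.2.1 p.2.2))
    (hu2 : ContDiff ℝ (⊤ : ℕ∞) (fun p : ℝ × ℝ × ℝ => u2 p.1 p.2.1 p.2.2))
    (hη : ContDiff ℝ (⊤ : ℕ∞) (fun p : ℝ × ℝ × ℝ => η p.1 p.2.1 p.2.2))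
    (hηpos : ∀ x y t, 0 < η x y t)
    (v1 v2 B : ℝ → ℝ → ℝ → ℝ)
    (hv1 : v1 = fun x y t => u1 x y t - κ * pd1 (fun x y t => Real.log (η x y t)) x y t)
    (hv2 : v2 = fun x y t => u2 x y t - κ * pd2 (fun x y t => Real.log (η x y t)) x y t)
    (hB : B = fun x y t => (u1 x y t ^ 2 + u2 x y t ^ 2) / 2
        - (κ / η x y t) * (pd1 (fun x y t => η x y t * u1 x y t) x y t
            + pd2 (fun x y t => η x y t * u2 x y t) x y t)
        - η x y t)
    (hmom1 : ∀ x y t, pdt u1 x y t + v1 x y t * pd1 u1 x y t + v2 x y t * pd2 u1 x y t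
        + u1 x y t * pd1 v1 x y t + u2 x y t * pd1 v2 x y t = pd1 B x y t)
    (hmom2 : ∀ x y t, pdt u2 x y t + v1 x y t * pd1 u2 x y t + v2 x y t * pd2 u2 x y t
        + u1 x y t * pd2 v1 x y t + u2 x y t * pd2 v2 x y t = pd2 B x y t)
    (hcont : ∀ x y t, pdt η x y t + pd1 (fun x y t => η x y t * v1 x y t) x y t
        + pd2 (fun x y t => η x y t * v2 x y t) x y t = 0)
    (ω : ℝ → ℝ → ℝ → ℝ)
    (hω : ω = fun x y t => pd1 u2 x y t - pd2 u1 x y t) :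
    (∀ x y t, pdt ω x y t + pd1 (fun x y t => ω x y t * v1 x y t) x y t
        + pd2 (fun x y t => ω x y t * v2 x y t) x y t = 0) ∧
    (∀ x y t, pdt ω x y t + v1 x y t * pd1 ω x y t + v2 x y t * pd2 ω x y t
        + ω x y t * (pd1 v1 x y t + pd2 v2 x y t) = 0) := by
  have su1 : JointlySmooth u1 := hu1
  have su2 : JointlySmooth u2 := hu2
  have sη : JointlySmooth η := hη
  have hη0 : ∀ x y t, η x y t ≠ 0 := fun x y t => (hηpos x y t).ne'
  have sv1 : JointlySmooth v1 := hv1 ▸ su1.sub ((JointlySmooth.const κ).mul (sη.log hη0).pd1)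
  have sv2 : JointlySmooth v2 := hv2 ▸ su2.sub ((JointlySmooth.const κ).mul (sη.log hη0).pd2)
  have sE : JointlySmooth (fun x y t => (u1 x y t ^ 2 + u2 x y t ^ 2) / 2) :=
    ((ContDiff.pow hu1 2).add (ContDiff.pow hu2 2)).div_const 2
  have sB : JointlySmooth B := hB ▸
    (sE.sub (((JointlySmooth.const κ).div sη hη0).mul
      ((sη.mul su1).pd1.add (sη.mul su2).pd2))).sub sη
  have sω : JointlySmooth ω := hω ▸ su2.pd1.sub su1.pd2
  have main := vorticity_conservation su1 su2 sv1 sv2 sB hmom1 hmom2 hω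
  refine ⟨main, fun x y t => ?_⟩
  have h := main x y t
  rw [(sω.mul sv1).pd1_eq, (sω.mul sv2).pd2_eq, sω.dirDeriv_mul sv1, sω.dirDeriv_mul sv2] at h
  rw [sω.pd1_eq, sω.pd2_eq, sv1.pd1_eq, sv2.pd2_eq]
  linear_combination h
end
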